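/- There do not exist elements η and t of ℤ[ω] such that η ≡ 2 (mod 3), η ≡ ω² (mod 2), and η divides t³ − 2 in ℤ[ω]. -/

import Mathlib

open Polynomial

/-- The ring of Eisenstein integers ℤ[ω] = ℤ[X]/(X² + X + 1). -/
abbrev Eisenstein : Type := AdjoinRoot (X ^ 2 + X + 1 : ℤ[X])

/-- ω, a primitive cube root of unity, satisfying ω² + ω + 1 = 0. -/
noncomputable def ω : Eisenstein := AdjoinRoot.root _

namespace EisAux

lemma omega_sq : ω ^ 2 = -1 - ω := by
  have h : (AdjoinRoot.mk (X ^ 2 + X + 1 : ℤ[X])) (X ^ 2 + X + 1) = 0 := AdjoinRoot.mk_self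
  simp only [map_add, map_pow, map_one, AdjoinRoot.mk_X] at h
  change ω ^ 2 + ω + 1 = 0 at h
  linear_combination h

lemma omega_cube : ω ^ 3 = 1 := by
  linear_combination (ω - 1) * omega_sq

lemma exists_coord (x : Eisenstein) : ∃ a b : ℤ, x = a + b * ω := by
  induction x using AdjoinRoot.induction_on with
  | ih q =>
    induction q using Polynomial.induction_on' with
    | add p q hp hq =>
      obtain ⟨a, b, h⟩ := hp
      obtain ⟨c, d, h'⟩ := hq
      refine ⟨a + c, b + d, ?_⟩
      rw [map_add, h, h']
      push_cast
      ring
    | monomial n r =>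
      induction n with
      | zero =>
        refine ⟨r, 0, ?_⟩
        simp
      | succ n ih =>
        obtain ⟨a, b, h⟩ := ih
        refine ⟨-b, a - b, ?_⟩
        rw [← Polynomial.monomial_mul_X, map_mul, h, AdjoinRoot.mk_X]
        change _ * ω = _
        push_cast
        linear_combination (b : Eisenstein) * omega_sq

/-- evaluation homomorphism at a root of `X ^ 2 + X + 1` -/
noncomputable def ev {S : Type*} [CommRing S] (r : S) (hr : r ^ 2 + r + 1 = 0) :
    Eisenstein →+* S :=
  AdjoinRoot.lift (Int.castRingHom S) r (by simpa using hr)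

lemma ev_omega {S : Type*} [CommRing S] (r : S) (hr : r ^ 2 + r + 1 = 0) : ev r hr ω = r :=
  AdjoinRoot.lift_root _

lemma ev_coord {S : Type*} [CommRing S] (r : S) (hr : r ^ 2 + r + 1 = 0) (a b : ℤ) :
    ev r hr (a + b * ω) = a + b * r := by
  simp [ev_omega]

noncomputable def μ : ℂ := ⟨-1 / 2, Real.sqrt 3 / 2⟩

lemma mu_root : μ ^ 2 + μ + 1 = 0 := by
  have h : Real.sqrt 3 * Real.sqrt 3 = 3 := Real.mul_self_sqrt (by norm_num)
  apply Complex.ext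
  · simp [μ, pow_two]; nlinarith
  · simp [μ, pow_two]; ring

noncomputable def ι : Eisenstein →+* ℂ := ev μ mu_root

lemma coord_zero {a b : ℤ} (h : (a : ℂ) + b * μ = 0) : a = 0 ∧ b = 0 := by
  have h1 := congrArg Complex.im h
  have h2 := congrArg Complex.re h
  simp [μ] at h1 h2
  subst h1
  simp at h2
  exact ⟨h2, rfl⟩

lemma ι_inj : Function.Injective ι := by
  rw [injective_iff_map_eq_zero]
  intro x hx
  obtain ⟨a, b, rfl⟩ := exists_coord x
  rw [ι, ev_coord] at hx
  obtain ⟨rfl, rfl⟩ := coord_zero hx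
  simp

instance : IsDomain Eisenstein := ι_inj.isDomain ι

lemma coord_ext {a b c d : ℤ} (h : (a : Eisenstein) + b * ω = c + d * ω) : a = c ∧ b = d := by
  have h1 := congrArg ι h
  rw [ι, ev_coord, ev_coord] at h1
  have := coord_zero (a := a - c) (b := b - d) (by push_cast; linear_combination h1)
  omega

lemma omega_prim : IsPrimitiveRoot ω 3 := by
  refine IsPrimitiveRoot.iff_orderOf.2 ?_
  refine orderOf_eq_prime omega_cube ?_
  intro h
  have := coord_ext (a := 0) (b := 1) (c := 1) (d := 0) (by simpa using h)
  omega

lemma conj_root : (ω ^ 2) ^ 2 + ω ^ 2 + 1 = 0 := by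
  linear_combination (ω ^ 2 - ω + 1) * omega_sq

noncomputable def σ : Eisenstein →+* Eisenstein := ev (ω ^ 2) conj_root

lemma jac (p : ℕ) [Fact p.Prime] (hp : p % 3 = 1) (s : ZMod p) (hs : s ^ 3 = 2) :
    ∃ a g : ℤ, Odd a ∧ a ^ 2 - 6 * a * g + 36 * g ^ 2 = p := by
  have hpp : p.Prime := Fact.out
  have hp2 : p ≠ 2 := by rintro rfl; omega
  have hcard : 3 ∣ Fintype.card (ZMod p) - 1 := by rw [ZMod.card]; omega
  obtain ⟨χ, hχ⟩ := MulChar.exists_mulChar_orderOf (ZMod p) hcard omega_prim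
  have hχ3 : χ ^ 3 = 1 := by rw [← hχ]; exact pow_orderOf_eq_one χ
  have hχ1 : χ ≠ 1 := by rintro rfl; simp at hχ
  have hχ2 : χ * χ ≠ 1 := by
    intro h
    apply hχ1
    calc χ = χ ^ 3 * (χ * χ)⁻¹ := by group
      _ = 1 := by rw [hχ3, h]; simp
  set J := jacobiSum χ χ with hJ
  -- conjugate
  have hconj : χ.ringHomComp σ = χ⁻¹ := by
    rw [eq_inv_iff_mul_eq_one]
    ext u
    obtain ⟨k, _, hk⟩ := MulChar.exists_apply_eq_pow hχ3 omega_prim (u.ne_zero)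
    simp only [MulChar.coeToFun_mul, Pi.mul_apply, MulChar.ringHomComp_apply, MulChar.one_apply_coe]
    rw [hk, map_pow, σ, ev_omega, ← mul_pow]
    rw [show ω ^ 2 * ω = 1 by linear_combination omega_cube, one_pow]
  have hσJ : jacobiSum χ⁻¹ χ⁻¹ = σ J := by
    rw [← hconj, jacobiSum_ringHomComp]
  have hnorm : J * σ J = (p : Eisenstein) := by
    apply ι_inj
    rw [map_mul, ← hσJ, hJ, ← jacobiSum_ringHomComp, ← jacobiSum_ringHomComp]
    have hinv : (χ⁻¹).ringHomComp ι = (χ.ringHomComp ι)⁻¹ := by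
      rw [eq_inv_iff_mul_eq_one, ← MulChar.ringHomComp_mul]
      simp
    have hne : ∀ ψ : MulChar (ZMod p) Eisenstein, ψ ≠ 1 → ψ.ringHomComp ι ≠ 1 := by
      intro ψ h
      exact (MulChar.ringHomComp_ne_one_iff ι_inj).2 h
    rw [hinv, jacobiSum_mul_jacobiSum_inv]
    · simp
    · rw [ZMod.ringChar_zmod_n, ringChar.eq_zero]
      exact hpp.ne_zero.symm
    · exact hne _ hχ1
    · exact hne _ hχ1
    · rw [← MulChar.ringHomComp_mul]
      exact hne _ hχ2
  -- mod 3
  obtain ⟨z, _, hz⟩ := exists_jacobiSum_eq_neg_one_add (by norm_num) hχ3 hχ3 hcard omega_prim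
  -- mod 2
  have h20 : (2 : ZMod p) ≠ 0 := by
    intro h
    have h' : ((2 : ℕ) : ZMod p) = 0 := by exact_mod_cast h
    rw [ZMod.natCast_eq_zero_iff] at h'
    exact hp2 ((Nat.prime_dvd_prime_iff_eq hpp Nat.prime_two).1 h')
  have hs0 : s ≠ 0 := by
    rintro rfl
    apply h20
    rw [← hs]; simp
  have hχ2' : χ 2 = 1 := by
    rw [← hs, map_pow, ← MulChar.pow_apply' χ (by norm_num), hχ3]
    exact MulChar.one_apply (isUnit_iff_ne_zero.2 hs0)
  have hχh : χ (2⁻¹) = 1 := by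
    have : χ (2 * 2⁻¹) = 1 := by rw [mul_inv_cancel₀ h20, map_one]
    rwa [map_mul, hχ2', one_mul] at this
  have hhalf : (1 : ZMod p) - 2⁻¹ = 2⁻¹ := by field_simp; norm_num
  have hmod2 : (2 : Eisenstein) ∣ J - 1 := by
    rw [← Ideal.mem_span_singleton, ← Ideal.Quotient.mk_eq_mk_iff_sub_mem]
    have two0 : (2 : Eisenstein ⧸ Ideal.span {(2 : Eisenstein)}) = 0 := by
      have := Ideal.Quotient.eq_zero_iff_mem.2
        (Ideal.mem_span_singleton_self (2 : Eisenstein))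
      rwa [map_ofNat] at this
    rw [hJ, jacobiSum, ← Finset.add_sum_erase _ _ (Finset.mem_univ (2⁻¹ : ZMod p)), hhalf, hχh,
      map_add, map_sum]
    have : ∑ x ∈ Finset.univ.erase (2⁻¹ : ZMod p),
        Ideal.Quotient.mk (Ideal.span {(2 : Eisenstein)}) (χ x * χ (1 - x)) = 0 := by
      refine Finset.sum_involution (fun x _ => 1 - x) ?_ ?_ ?_ ?_
      · intro x _
        rw [sub_sub_cancel, mul_comm (χ (1 - x)), ← two_mul, two0, zero_mul]
      · intro x hx _ h
        refine (Finset.mem_erase.1 hx).1 ?_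
        refine eq_inv_of_mul_eq_one_left ?_
        linear_combination -h
      · intro x hx
        refine Finset.mem_erase.2 ⟨?_, Finset.mem_univ _⟩
        intro h
        refine (Finset.mem_erase.1 hx).1 ?_
        rw [← hhalf, ← h]; ring
      · intro x _
        ring
    rw [this]; simp
  obtain ⟨w, hw⟩ := hmod2
  obtain ⟨a, b, hab⟩ := exists_coord J
  obtain ⟨c, d, rfl⟩ := exists_coord z
  obtain ⟨e, f, rfl⟩ := exists_coord w
  have h3 := coord_ext (a := a) (b := b) (c := -1 + 3 * d) (d := -3 * c + 3 * d) (by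
    rw [← hab, hJ, hz]; push_cast
    linear_combination (c + d * ω - 3 * d) * omega_sq)
  have h2 := coord_ext (a := a) (b := b) (c := 1 + 2 * e) (d := 2 * f) (by
    rw [← hab]; push_cast
    linear_combination hw)
  have hN : a ^ 2 - a * b + b ^ 2 = p := by
    have := coord_ext (a := a ^ 2 - a * b + b ^ 2) (b := 0) (c := p) (d := 0) (by
      have hh := hnorm
      rw [hab, σ, ev_coord] at hh
      push_cast
      rw [← hh]
      linear_combination -(a * b : Eisenstein) * omega_sq - b ^ 2 * omega_cube)
    exact this.1
  obtain ⟨g, hg⟩ : (6 : ℤ) ∣ b := by omega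
  refine ⟨a, g, ⟨e, by omega⟩, ?_⟩
  rw [← hN, hg]; ring

/-- a unit times an element of `ℤ + 6ℤω` with odd real part -/
def Good (x : Eisenstein) : Prop :=
  ∃ (k : ℕ) (e g : ℤ), Odd e ∧ x = ω ^ k * (e + 6 * g * ω)

lemma Good.mul {x y : Eisenstein} (hx : Good x) (hy : Good y) : Good (x * y) := by
  obtain ⟨k, e, g, he, rfl⟩ := hx
  obtain ⟨k', e', g', he', rfl⟩ := hy
  refine ⟨k + k', e * e' - 36 * (g * g'), e * g' + e' * g - 6 * g * g', ?_, ?_⟩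
  · exact (he.mul he').sub_even (by rw [show (36 : ℤ) = 2 * 18 by norm_num, mul_assoc]; simp)
  · push_cast
    linear_combination ω ^ k * ω ^ k' * 36 * g * g' * omega_sq

lemma unit_case (c d : ℤ) (h : c ^ 2 - c * d + d ^ 2 = 1) : Good (c + d * ω) := by
  have hc : c ≤ 1 := by nlinarith [sq_nonneg (c - 2 * d)]
  have hc' : -1 ≤ c := by nlinarith [sq_nonneg (c - 2 * d)]
  have hd : d ≤ 1 := by nlinarith [sq_nonneg (d - 2 * c)]
  have hd' : -1 ≤ d := by nlinarith [sq_nonneg (d - 2 * c)]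
  have h0 := omega_sq
  interval_cases c <;> interval_cases d <;> norm_num at h
  · exact ⟨2, 1, 0, by decide, by push_cast; rw [h0]; ring⟩
  · exact ⟨0, -1, 0, by decide, by push_cast; ring⟩
  · exact ⟨1, -1, 0, by decide, by push_cast; ring⟩
  · exact ⟨1, 1, 0, by decide, by push_cast; ring⟩
  · exact ⟨0, 1, 0, by decide, by push_cast; ring⟩
  · exact ⟨2, -1, 0, by decide, by push_cast; rw [h0]; ring⟩

/-- primes congruent to 2 mod 3 are inert -/
lemma inert (p : ℕ) (hp : p.Prime) (h3 : p % 3 = 2) (h2 : p ≠ 2) (c d : ℤ)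
    (h : (p : ℤ) ∣ c ^ 2 - c * d + d ^ 2) : (p : ℤ) ∣ d := by
  have := Fact.mk hp
  rw [← ZMod.intCast_zmod_eq_zero_iff_dvd] at h ⊢
  push_cast at h
  by_contra hd
  set r : ZMod p := -(c / d : ZMod p) with hr
  have hroot : r ^ 2 + r + 1 = 0 := by
    rw [hr]; field_simp; linear_combination h
  have hr3 : r ^ 3 = 1 := by linear_combination (r - 1) * hroot
  have hr0 : r ≠ 0 := by rintro h0; rw [h0] at hr3; simp at hr3
  have hf : r ^ (p - 1) = 1 := ZMod.pow_card_sub_one_eq_one hr0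
  have hm : p - 1 = 3 * (p / 3) + 1 := by omega
  rw [hm, pow_add, pow_mul, hr3, one_pow, one_mul, pow_one] at hf
  rw [hf] at hroot
  have h' : ((3 : ℕ) : ZMod p) = 0 := by push_cast; linear_combination hroot
  rw [ZMod.natCast_eq_zero_iff] at h'
  have := (Nat.prime_dvd_prime_iff_eq hp Nat.prime_three).1 h'
  omega

/-- dividing out a split prime factor -/
lemma step (p m : ℕ) (hpp : Prime (p : ℤ)) (a g c d : ℤ) (ha : Odd a)
    (hag : a ^ 2 - 6 * a * g + 36 * g ^ 2 = p) (hn : c ^ 2 - c * d + d ^ 2 = p * m)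
    (hdv : (p : ℤ) ∣ a * d - 6 * g * c)
    (hsub : ∀ c' d' : ℤ, c' ^ 2 - c' * d' + d' ^ 2 = m → Good (c' + d' * ω)) :
    Good (c + d * ω) := by
  have hp0 : (p : ℤ) ≠ 0 := hpp.ne_zero
  have hpR : (a : Eisenstein) ^ 2 - 6 * a * g + 36 * g ^ 2 = p := by
    have := congrArg (Int.cast : ℤ → Eisenstein) hag
    push_cast at this
    exact this
  obtain ⟨v, hv⟩ := hdv
  have hnorm : (a * c - 6 * g * c + 6 * g * d) ^ 2
      - (a * c - 6 * g * c + 6 * g * d) * (a * d - 6 * g * c) + (a * d - 6 * g * c) ^ 2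
      = p * (p * m) := by
    rw [← hn, ← hag]; ring
  obtain ⟨u, hu⟩ : (p : ℤ) ∣ a * c - 6 * g * c + 6 * g * d := by
    refine hpp.dvd_of_dvd_pow (n := 2)
      ⟨p * m + (a * c - 6 * g * c + 6 * g * d) * v - p * v ^ 2, ?_⟩
    rw [hv] at hnorm
    linear_combination hnorm
  rw [hu, hv] at hnorm
  have hx : (c + d * ω : Eisenstein) = (a + 6 * g * ω) * (u + v * ω) := by
    have hpE : (p : Eisenstein) ≠ 0 := by
      intro h
      have := coord_ext (a := p) (b := 0) (c := 0) (d := 0) (by simpa using h)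
      exact hp0 this.1
    apply mul_left_cancel₀ hpE
    have hu' : (a * c - 6 * g * c + 6 * g * d : Eisenstein) = p * u := by
      have := congrArg (Int.cast : ℤ → Eisenstein) hu
      push_cast at this
      exact this
    have hv' : (a * d - 6 * g * c : Eisenstein) = p * v := by
      have := congrArg (Int.cast : ℤ → Eisenstein) hv
      push_cast at this
      exact this
    linear_combination -(c + d * ω) * hpR + (a + 6 * g * ω) * (hu' + ω * hv')
      - (6 * g * (a * d - 6 * g * c)) * omega_sq
  rw [hx]
  refine Good.mul ⟨0, a, g, ha, by simp⟩ (hsub u v ?_)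
  apply mul_left_cancel₀ (pow_ne_zero 2 hp0)
  linear_combination hnorm

lemma main (n : ℕ) : ∀ c d : ℤ, c ^ 2 - c * d + d ^ 2 = n → ¬ 3 ∣ n → ¬ 2 ∣ n →
    (∀ p : ℕ, p.Prime → p ∣ n → p % 3 = 1 → ∃ s : ZMod p, s ^ 3 = 2) → Good (c + d * ω) := by
  induction n using Nat.strong_induction_on with
  | _ n ih =>
  intro c d hn hn3 hn2 hcube
  by_cases h1 : n = 1
  · subst h1
    exact unit_case c d (by simpa using hn)
  have hn0 : 0 < n := by
    rcases Nat.eq_zero_or_pos n with rfl | h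
    · simp at hn3
    · exact h
  obtain ⟨p, hp, m, rfl⟩ := Nat.exists_prime_and_dvd h1
  have hm0 : 0 < m := Nat.pos_of_mul_pos_left hn0
  have hp0 : (p : ℤ) ≠ 0 := by exact_mod_cast hp.ne_zero
  have hpp : Prime (p : ℤ) := Nat.prime_iff_prime_int.1 hp
  have hp2 : p ≠ 2 := by rintro rfl; exact hn2 (dvd_mul_right _ _)
  have hp3 : p ≠ 3 := by rintro rfl; exact hn3 (dvd_mul_right _ _)
  have hp3' : p % 3 ≠ 0 := fun h =>
    hp3 ((Nat.prime_dvd_prime_iff_eq Nat.prime_three hp).1 (Nat.dvd_of_mod_eq_zero h)).symm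
  push_cast at hn
  have hodd : Odd (p : ℤ) := by exact_mod_cast hp.odd_of_ne_two hp2
  by_cases hps : p % 3 = 1
  · obtain ⟨s, hs⟩ := hcube p hp (dvd_mul_right _ _) hps
    have := Fact.mk hp
    obtain ⟨a, g, ha, hag⟩ := jac p hps s hs
    have hlt : m < p * m := by nlinarith [hp.two_le]
    have hsub : ∀ c' d' : ℤ, c' ^ 2 - c' * d' + d' ^ 2 = m → Good (c' + d' * ω) := by
      intro c' d' h
      refine ih m hlt c' d' h (fun h => hn3 (h.mul_left _)) (fun h => hn2 (h.mul_left _)) ?_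
      intro q hq hqm
      exact hcube q hq (hqm.mul_left _)
    have hdv : (p : ℤ) ∣ (a * d - 6 * g * c) * (a * d + 6 * g * c - 6 * g * d) :=
      ⟨d ^ 2 - 36 * g ^ 2 * m, by linear_combination d ^ 2 * hag - 36 * g ^ 2 * hn⟩
    rcases hpp.dvd_or_dvd hdv with h | h
    · exact step p m hpp a g c d ha hag hn h hsub
    · refine step p m hpp (a - 6 * g) (-g) c d ?_ ?_ hn ?_ hsub
      · exact ha.sub_even (by rw [show (6 : ℤ) = 2 * 3 by norm_num, mul_assoc]; simp)
      · rw [← hag]; ring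
      · have e : (a - 6 * g) * d - 6 * (-g) * c = a * d + 6 * g * c - 6 * g * d := by ring
        rw [e]; exact h
  · have hps2 : p % 3 = 2 := by omega
    obtain ⟨d', rfl⟩ := inert p hp hps2 hp2 c d ⟨m, hn⟩
    obtain ⟨c', rfl⟩ := inert p hp hps2 hp2 (p * d') c ⟨m, by rw [← hn]; ring⟩
    have hm : (p : ℤ) * (c' ^ 2 - c' * d' + d' ^ 2) = m :=
      mul_left_cancel₀ hp0 (by rw [← hn]; ring)
    obtain ⟨m', rfl⟩ : p ∣ m := by
      have : (p : ℤ) ∣ m := ⟨_, hm.symm⟩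
      exact_mod_cast this
    push_cast at hm
    have hm' := mul_left_cancel₀ hp0 hm
    have hm0' : 0 < m' := Nat.pos_of_mul_pos_left hm0
    have hlt : m' < p * (p * m') := by
      have := hp.two_le
      have : m' < p * m' := by nlinarith
      nlinarith
    have hg := ih m' hlt c' d' hm' (fun h => hn3 ((h.mul_left _).mul_left _))
      (fun h => hn2 ((h.mul_left _).mul_left _))
      (fun q hq hqm => hcube q hq ((hqm.mul_left _).mul_left _))
    have hx : (((p * c' : ℤ) : Eisenstein) + ((p * d' : ℤ) : Eisenstein) * ω)
        = p * (c' + d' * ω) := by push_cast; ring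
    rw [hx]
    refine Good.mul ⟨0, p, 0, hodd, by simp⟩ hg

end EisAux

open EisAux in
theorem no_eta_with_cube_two :
    ¬ ∃ η t : Eisenstein,
      (3 : Eisenstein) ∣ (η - 2) ∧ (2 : Eisenstein) ∣ (η - ω ^ 2) ∧ η ∣ (t ^ 3 - 2) := by
  rintro ⟨η, t, ⟨x, hx⟩, ⟨y, hy⟩, hdvd⟩
  obtain ⟨c, d, rfl⟩ := exists_coord η
  obtain ⟨x1, x2, rfl⟩ := exists_coord x
  obtain ⟨y1, y2, rfl⟩ := exists_coord y
  have h3 := coord_ext (a := c) (b := d) (c := 2 + 3 * x1) (d := 3 * x2) (by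
    push_cast; linear_combination hx)
  have h2 := coord_ext (a := c) (b := d) (c := -1 + 2 * y1) (d := -1 + 2 * y2) (by
    push_cast; linear_combination hy + omega_sq)
  have hnn : 0 ≤ c ^ 2 - c * d + d ^ 2 := by nlinarith [sq_nonneg (c - d), sq_nonneg c, sq_nonneg d]
  obtain ⟨n, hn⟩ := Int.eq_ofNat_of_zero_le hnn
  have hgood : Good (c + d * ω) := by
    refine main n c d hn ?_ ?_ ?_
    · intro h
      have h' : (3 : ℤ) ∣ n := by exact_mod_cast h
      rw [← hn, h3.1, h3.2] at h'
      obtain ⟨k, hk⟩ := h'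
      ring_nf at hk
      omega
    · intro h
      have h' : (2 : ℤ) ∣ n := by exact_mod_cast h
      rw [← hn, h2.1, h2.2] at h'
      obtain ⟨k, hk⟩ := h'
      ring_nf at hk
      omega
    · intro p hp hpn hp1
      have := Fact.mk hp
      have hcard : 3 ∣ Fintype.card (ZMod p)ˣ := by rw [ZMod.card_units]; omega
      have : Fact (Nat.Prime 3) := ⟨Nat.prime_three⟩
      obtain ⟨u, hu⟩ := exists_prime_orderOf_dvd_card 3 hcard
      have hu1 : (u : ZMod p) ≠ 1 := by
        intro h
        rw [Units.val_eq_one.1 h] at hu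
        simp at hu
      have hu3 : (u : ZMod p) ^ 3 = 1 := by
        rw [← Units.val_pow_eq_pow_val, ← hu, pow_orderOf_eq_one]; rfl
      generalize (u : ZMod p) = r at hu1 hu3
      have hr : r ^ 2 + r + 1 = 0 := by
        apply mul_left_cancel₀ (sub_ne_zero.2 hu1)
        linear_combination hu3
      have hr' : (r ^ 2) ^ 2 + r ^ 2 + 1 = 0 := by linear_combination (r ^ 2 - r + 1) * hr
      have hz : ((c : ZMod p) + d * r) * (c + d * r ^ 2) = 0 := by
        have h0 : ((c ^ 2 - c * d + d ^ 2 : ℤ) : ZMod p) = 0 := by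
          rw [hn]; push_cast
          exact (ZMod.natCast_eq_zero_iff _ _).2 hpn
        push_cast at h0
        linear_combination h0 + c * d * hr + d ^ 2 * hu3
      have key : ∀ q : ZMod p, ∀ hq : q ^ 2 + q + 1 = 0, (c : ZMod p) + d * q = 0 →
          ∃ s : ZMod p, s ^ 3 = 2 := by
        intro q hq h0
        refine ⟨ev q hq t, ?_⟩
        have := map_dvd (ev q hq) hdvd
        rw [ev_coord, h0, zero_dvd_iff, map_sub, map_pow, map_ofNat] at this
        exact sub_eq_zero.1 this
      rcases mul_eq_zero.1 hz with h | h
      · exact key r hr h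
      · exact key _ hr' h
  obtain ⟨k, e, g, he, hk⟩ := hgood
  have hk3 : ω ^ k = ω ^ (k % 3) := pow_eq_pow_mod k omega_cube
  rw [hk3] at hk
  have : k % 3 < 3 := Nat.mod_lt _ (by norm_num)
  generalize k % 3 = j at this hk
  interval_cases j
  · have := coord_ext (a := c) (b := d) (c := e) (d := 6 * g) (by
      rw [hk]; push_cast; ring)
    omega
  · have := coord_ext (a := c) (b := d) (c := - 6 * g) (d := e - 6 * g) (by
      rw [hk]; push_cast; linear_combination 6 * g * omega_sq)
    omega
  · have := coord_ext (a := c) (b := d) (c := 6 * g - e) (d := -e) (by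
      rw [hk]; push_cast; linear_combination e * omega_sq + 6 * g * omega_cube)
    omega
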